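/- arXiv:1905.04512 — 3 statements merged into one kernel-verified Lean document; each statement's English description precedes it below -/
import Mathlib

section
/- Fix a real constant b ≠ 0. On ℝ² the vector fields X₁(x,y) = (b·e^{−x/b}, ((−1 + e^{−(1+b)y})·e^{−x/b})/b) and X₂(x,y) = (b, 0) satisfy [X₁, X₂] = X₁, so they span a two-dimensional Lie algebra isomorphic to the non-abelian Lie algebra A₂. -/
open Real

/-- The Lie bracket of vector fields on `ℝ²` (identified with smooth maps
`ℝ² → ℝ²`): `[X,Y](p) = DY(p)(X(p)) − DX(p)(Y(p))`. -/
noncomputable def lieBr (X Y : (Fin 2 → ℝ) → (Fin 2 → ℝ)) (p : Fin 2 → ℝ) : Fin 2 → ℝ :=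
  fderiv ℝ Y p (X p) - fderiv ℝ X p (Y p)

/-- X₁(x,y) = (b·e^{−x/b}, ((−1 + e^{−(1+b)y})·e^{−x/b})/b). -/
noncomputable def X₁ (b : ℝ) : (Fin 2 → ℝ) → (Fin 2 → ℝ) := fun p =>
  ![b * exp (-(p 0) / b), ((-1 + exp (-(1 + b) * p 1)) * exp (-(p 0) / b)) / b]

/-- X₂(x,y) = (b, 0). -/
noncomputable def X₂ (b : ℝ) : (Fin 2 → ℝ) → (Fin 2 → ℝ) := fun _ => ![b, 0]

theorem differentiable_X₁ (b : ℝ) : Differentiable ℝ (X₁ b) := by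
  rw [differentiable_pi]
  intro i
  fin_cases i <;> simp only [X₁] <;> simp <;> fun_prop

/-- Moving along `X₂` for time `t` rescales `X₁` by `exp (-t)`. -/
theorem X₁_add_smul_X₂ (b : ℝ) (hb : b ≠ 0) (p : Fin 2 → ℝ) (t : ℝ) :
    X₁ b (p + t • X₂ b p) = exp (-t) • X₁ b p := by
  have h : exp (-(p 0 + t * b) / b) = exp (-t) * exp (-(p 0) / b) := by
    rw [← exp_add]
    congr 1
    field_simp
    ring
  ext i
  fin_cases i <;> simp [X₁, X₂, -neg_add_rev, h] <;> ring

theorem fderiv_X₁_X₂ (b : ℝ) (hb : b ≠ 0) (p : Fin 2 → ℝ) :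
    fderiv ℝ (X₁ b) p (X₂ b p) = -X₁ b p := by
  rw [← (differentiable_X₁ b p).lineDeriv_eq_fderiv]
  have h : HasDerivAt (fun t : ℝ => exp (-t) • X₁ b p) (-X₁ b p) 0 := by
    simpa using ((hasDerivAt_neg (0 : ℝ)).exp.smul_const (X₁ b p))
  simpa only [lineDeriv, X₁_add_smul_X₂ b hb p] using h.deriv

/-- For `b ≠ 0`, the vector fields `X₁`, `X₂` on `ℝ²` satisfy `[X₁, X₂] = X₁`,
so they span a two-dimensional Lie algebra isomorphic to the non-abelian Lie
algebra `A₂`. -/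
theorem stmt_1 (b : ℝ) (hb : b ≠ 0) (p : Fin 2 → ℝ) :
    lieBr (X₁ b) (X₂ b) p = X₁ b p := by
  have h : fderiv ℝ (X₂ b) p = 0 := fderiv_const_apply _
  simp [lieBr, h, fderiv_X₁_X₂ b hb p]
end

section
/- Fix a real constant b. On ℝ³ the pair (Λ, E) with Λ^{12} = ½(1 − e^{b(y−z)}), Λ^{13} = −½(1 − e^{b(y−z)}), Λ^{23} = (y+z)·e^{b(y−z)} and E = (−b, 0, 0) is a Jacobi structure: at every point, (i) Σ_l [Λ^{1l}∂_l Λ^{23} + Λ^{2l}∂_l Λ^{31} + Λ^{3l}∂_l Λ^{12}] + E¹Λ^{23} + E²Λ^{31} + E³Λ^{12} = 0, and (ii) Σ_l E^l ∂_l Λ^{μν} − Σ_l Λ^{lν} ∂_l E^μ − Σ_l Λ^{μl} ∂_l E^ν = 0 for all μ,ν ∈ {1,2,3}. -/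
open Real

/-- Partial derivative `∂_μ f` on `ℝ³`. -/
noncomputable def pd (μ : Fin 3) (f : (Fin 3 → ℝ) → ℝ) (p : Fin 3 → ℝ) : ℝ :=
  fderiv ℝ f p (Pi.single μ 1)

/-- The components `Λ^{μν}` (as scalar functions on `ℝ³`) of the bivector with
`Λ^{12} = ½(1 − e^{b(y−z)})`, `Λ^{13} = −½(1 − e^{b(y−z)})`,
`Λ^{23} = (y+z)·e^{b(y−z)}`, extended antisymmetrically. -/
noncomputable def L (b : ℝ) : Fin 3 → Fin 3 → (Fin 3 → ℝ) → ℝ :=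
  ![![fun _ => 0,
     fun p => (1 - exp (b * (p 1 - p 2))) / 2,
     fun p => -((1 - exp (b * (p 1 - p 2))) / 2)],
    ![fun p => -((1 - exp (b * (p 1 - p 2))) / 2),
     fun _ => 0,
     fun p => (p 1 + p 2) * exp (b * (p 1 - p 2))],
    ![fun p => (1 - exp (b * (p 1 - p 2))) / 2,
     fun p => -((p 1 + p 2) * exp (b * (p 1 - p 2))),
     fun _ => 0]]

/-- The components of the vector field `E = (−b, 0, 0)`. -/
noncomputable def E (b : ℝ) : Fin 3 → (Fin 3 → ℝ) → ℝ :=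
  ![fun _ => -b, fun _ => 0, fun _ => 0]

lemma pd_eq_of_hasFDerivAt {μ : Fin 3} {f : (Fin 3 → ℝ) → ℝ} {f' : (Fin 3 → ℝ) →L[ℝ] ℝ}
    {p : Fin 3 → ℝ} (h : HasFDerivAt f f' p) : pd μ f p = f' (Pi.single μ 1) := by
  rw [pd, h.fderiv]

lemma pd_const (μ : Fin 3) (c : ℝ) (p : Fin 3 → ℝ) : pd μ (fun _ => c) p = 0 := by
  simp [pd]

lemma pd_neg (μ : Fin 3) (f : (Fin 3 → ℝ) → ℝ) (p : Fin 3 → ℝ) :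
    pd μ (fun q => -f q) p = -pd μ f p := by
  simp [pd, fderiv_fun_neg]

lemma hasFDerivAt_exp_mul_sub (b : ℝ) (p : Fin 3 → ℝ) :
    HasFDerivAt (fun q : Fin 3 → ℝ => exp (b * (q 1 - q 2)))
      (exp (b * (p 1 - p 2)) • b • (ContinuousLinearMap.proj (R := ℝ) (φ := fun _ : Fin 3 => ℝ) 1
        - ContinuousLinearMap.proj 2)) p :=
  (((hasFDerivAt_apply 1 p).sub (hasFDerivAt_apply 2 p)).const_mul b).exp

lemma pd_half_one_sub_exp (μ : Fin 3) (b : ℝ) (p : Fin 3 → ℝ) :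
    pd μ (fun q => (1 - exp (b * (q 1 - q 2))) / 2) p =
      ![0, -(b * exp (b * (p 1 - p 2)) / 2), b * exp (b * (p 1 - p 2)) / 2] μ := by
  simp only [div_eq_mul_inv]
  rw [pd_eq_of_hasFDerivAt (((hasFDerivAt_exp_mul_sub b p).const_sub 1).mul_const _)]
  fin_cases μ <;> simp <;> ring

lemma pd_add_mul_exp (μ : Fin 3) (b : ℝ) (p : Fin 3 → ℝ) :
    pd μ (fun q => (q 1 + q 2) * exp (b * (q 1 - q 2))) p =
      ![0, (1 + b * (p 1 + p 2)) * exp (b * (p 1 - p 2)),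
        (1 - b * (p 1 + p 2)) * exp (b * (p 1 - p 2))] μ := by
  rw [pd_eq_of_hasFDerivAt (((hasFDerivAt_apply 1 p).fun_add (hasFDerivAt_apply 2 p)).fun_mul
    (hasFDerivAt_exp_mul_sub b p))]
  fin_cases μ <;> simp <;> ring

/-- The pair `(Λ, E)` with `Λ^{12} = ½(1 − e^{b(y−z)})`,
`Λ^{13} = −½(1 − e^{b(y−z)})`, `Λ^{23} = (y+z)·e^{b(y−z)}`, `E = (−b, 0, 0)`
is a Jacobi structure on `ℝ³`: (i) the coordinate form of `[Λ,Λ] = 2E∧Λ` and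
(ii) the coordinate form of `L_E Λ = 0` hold at every point. -/
theorem stmt_4 (b : ℝ) (p : Fin 3 → ℝ) :
    ((∑ l : Fin 3, (L b 0 l p * pd l (L b 1 2) p + L b 1 l p * pd l (L b 2 0) p
        + L b 2 l p * pd l (L b 0 1) p))
      + E b 0 p * L b 1 2 p + E b 1 p * L b 2 0 p + E b 2 p * L b 0 1 p = 0) ∧
    (∀ μ ν : Fin 3,
      (∑ l : Fin 3, E b l p * pd l (L b μ ν) p)
        - (∑ l : Fin 3, L b l ν p * pd l (E b μ) p)
        - (∑ l : Fin 3, L b μ l p * pd l (E b ν) p) = 0) := by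
  constructor
  · simp [Fin.sum_univ_three, L, E, pd_half_one_sub_exp, pd_add_mul_exp]
    ring
  · intro μ ν
    fin_cases μ <;> fin_cases ν <;>
      simp [Fin.sum_univ_three, L, E, pd_const, pd_neg, pd_half_one_sub_exp, pd_add_mul_exp]
end

section
/- Fix a real constant b ≠ 0 and work on U = {(x,y,z) ∈ ℝ³ : b(y+z) < 0}. With Ei(w) = ∫_w^∞ e^{−t}/t dt for w > 0, consider the Jacobi structure Λ^{12} = ½(1 − e^{b(y−z)}), Λ^{13} = −½(1 − e^{b(y−z)}), Λ^{23} = (y+z)·e^{b(y−z)}, E = (−b, 0, 0), and the functions f₁ = 1, f₂ = y, f₃ = −e^{−2by}·Ei(−b(y+z)). Then E f₁ = E f₂ = E f₃ = 0 on U (they are good Hamiltonian functions) and {f₂, f₃} = f₁ on U. -/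
open Real

/-- The exponential integral `Ei(w) = ∫_w^∞ e^{−t}/t dt` (for `w > 0`). -/
noncomputable def Ei (w : ℝ) : ℝ := ∫ t in Set.Ioi w, exp (-t) / t

/-- The directional derivative `Ef = Σ_μ E^μ ∂_μ f` of `f` along `E`. -/
noncomputable def Edir (E : (Fin 3 → ℝ) → Fin 3 → ℝ) (f : (Fin 3 → ℝ) → ℝ)
    (p : Fin 3 → ℝ) : ℝ :=
  ∑ μ : Fin 3, E p μ * pd μ f p

/-- The Jacobi bracket of `f, g`:
`{f,g} = Σ_{μ,ν} Λ^{μν}·(∂_μ f)·(∂_ν g) + f·(Eg) − g·(Ef)`. -/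
noncomputable def jb (Λ : (Fin 3 → ℝ) → Fin 3 → Fin 3 → ℝ)
    (E : (Fin 3 → ℝ) → Fin 3 → ℝ) (f g : (Fin 3 → ℝ) → ℝ) (p : Fin 3 → ℝ) : ℝ :=
  (∑ μ : Fin 3, ∑ ν : Fin 3, Λ p μ ν * pd μ f p * pd ν g p)
    + f p * Edir E g p - g p * Edir E f p

/-- The bivector with `Λ^{12} = ½(1 − e^{b(y−z)})`, `Λ^{13} = −½(1 − e^{b(y−z)})`,
`Λ^{23} = (y+z)·e^{b(y−z)}`. -/
noncomputable def Lam (b : ℝ) : (Fin 3 → ℝ) → Fin 3 → Fin 3 → ℝ := fun p =>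
  ![![0, (1 - exp (b * (p 1 - p 2))) / 2, -((1 - exp (b * (p 1 - p 2))) / 2)],
    ![-((1 - exp (b * (p 1 - p 2))) / 2), 0, (p 1 + p 2) * exp (b * (p 1 - p 2))],
    ![(1 - exp (b * (p 1 - p 2))) / 2, -((p 1 + p 2) * exp (b * (p 1 - p 2))), 0]]

/-- The Reeb vector field `E = (−b, 0, 0)`. -/
noncomputable def Evec (b : ℝ) : (Fin 3 → ℝ) → Fin 3 → ℝ := fun _ => ![-b, 0, 0]

/-- f₁ = 1. -/
noncomputable def f₁ : (Fin 3 → ℝ) → ℝ := fun _ => 1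

/-- f₂ = y. -/
noncomputable def f₂ : (Fin 3 → ℝ) → ℝ := fun q => q 1

/-- f₃ = −e^{−2by}·Ei(−b(y+z)). -/
noncomputable def f₃ (b : ℝ) : (Fin 3 → ℝ) → ℝ := fun q =>
  -(exp (-(2 * b * q 1)) * Ei (-b * (q 1 + q 2)))

open MeasureTheory Set

theorem integrableOn_exp_neg_div_Ioi {a : ℝ} (ha : 0 < a) :
    IntegrableOn (fun t : ℝ => exp (-t) / t) (Ioi a) := by
  refine Integrable.mono' ((integrableOn_exp_neg_Ioi a).div_const a)
    (Measurable.aestronglyMeasurable (by fun_prop)) ?_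
  filter_upwards [ae_restrict_mem measurableSet_Ioi] with t (ht : a < t)
  rw [norm_of_nonneg (div_nonneg (exp_pos _).le (ha.trans ht).le)]
  gcongr

theorem hasDerivAt_Ei {w : ℝ} (hw : 0 < w) : HasDerivAt Ei (-(exp (-w) / w)) w := by
  have hcont : ContinuousOn (fun t : ℝ => exp (-t) / t) (Ioi 0) :=
    ContinuousOn.div (by fun_prop) continuousOn_id fun t ht => ne_of_gt ht
  have hint : IntervalIntegrable (fun t : ℝ => exp (-t) / t) volume (w / 2) w :=
    (hcont.mono fun t ht => by
      rw [uIcc_of_le (by linarith)] at ht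
      exact (half_pos hw).trans_le ht.1).intervalIntegrable
  have hderiv := (intervalIntegral.integral_hasDerivAt_right hint
    (hcont.stronglyMeasurableAtFilter isOpen_Ioi w hw)
    (hcont.continuousAt (Ioi_mem_nhds hw))).const_sub (Ei (w / 2))
  refine hderiv.congr_of_eventuallyEq ?_
  filter_upwards [Ioi_mem_nhds hw] with v hv
  rw [← intervalIntegral.integral_Ioi_sub_Ioi' (integrableOn_exp_neg_div_Ioi (half_pos hw))
    (integrableOn_exp_neg_div_Ioi hv)]
  simp [Ei]

theorem hasFDerivAt_f₂ (p : Fin 3 → ℝ) :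
    HasFDerivAt f₂ (ContinuousLinearMap.proj (R := ℝ) (φ := fun _ : Fin 3 => ℝ) 1) p :=
  hasFDerivAt_apply 1 p

theorem pd_f₂ (μ : Fin 3) (p : Fin 3 → ℝ) : pd μ f₂ p = ![0, 1, 0] μ := by
  rw [pd, (hasFDerivAt_f₂ p).fderiv]
  fin_cases μ <;> simp

theorem hasFDerivAt_f₃ {b : ℝ} {p : Fin 3 → ℝ} (hp : b * (p 1 + p 2) < 0) :
    HasFDerivAt (f₃ b)
      ((2 * b * exp (-(2 * b * p 1)) * Ei (-b * (p 1 + p 2))) •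
          ContinuousLinearMap.proj (R := ℝ) (φ := fun _ : Fin 3 => ℝ) 1 +
        (exp (-(b * (p 1 - p 2))) / (p 1 + p 2)) •
          (ContinuousLinearMap.proj (R := ℝ) (φ := fun _ : Fin 3 => ℝ) 1 +
            ContinuousLinearMap.proj (R := ℝ) (φ := fun _ : Fin 3 => ℝ) 2)) p := by
  have hb : b ≠ 0 := left_ne_zero_of_mul hp.ne
  have hs : p 1 + p 2 ≠ 0 := right_ne_zero_of_mul hp.ne
  have hy : HasFDerivAt (fun q : Fin 3 → ℝ => q 1)
      (ContinuousLinearMap.proj (R := ℝ) (φ := fun _ : Fin 3 => ℝ) 1) p := hasFDerivAt_apply 1 p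
  have hz : HasFDerivAt (fun q : Fin 3 → ℝ => q 2)
      (ContinuousLinearMap.proj (R := ℝ) (φ := fun _ : Fin 3 => ℝ) 2) p := hasFDerivAt_apply 2 p
  have hEi := (hasDerivAt_Ei (w := -b * (p 1 + p 2)) (by linarith)).comp_hasFDerivAt p
    ((hy.add hz).const_mul (-b))
  refine (((hy.const_mul (2 * b)).neg.exp).mul hEi).neg.congr_fderiv ?_
  have hexp : exp (-(b * (p 1 - p 2))) =
      exp (-(2 * b * p 1)) * exp (-(-b * (p 1 + p 2))) := by
    rw [← exp_add]
    ring_nf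
  ext v
  simp only [hexp, add_apply, smul_apply, neg_apply, ContinuousLinearMap.proj_apply,
    smul_eq_mul, Function.comp_apply, Pi.add_apply, Pi.neg_apply]
  field_simp
  ring

theorem pd_f₃ {b : ℝ} {p : Fin 3 → ℝ} (hp : b * (p 1 + p 2) < 0) (μ : Fin 3) :
    pd μ (f₃ b) p =
      ![0,
        2 * b * exp (-(2 * b * p 1)) * Ei (-b * (p 1 + p 2)) +
          exp (-(b * (p 1 - p 2))) / (p 1 + p 2),
        exp (-(b * (p 1 - p 2))) / (p 1 + p 2)] μ := by
  rw [pd, (hasFDerivAt_f₃ hp).fderiv]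
  fin_cases μ <;> simp

theorem Edir_Evec (b : ℝ) (f : (Fin 3 → ℝ) → ℝ) (p : Fin 3 → ℝ) :
    Edir (Evec b) f p = -b * pd 0 f p := by
  simp [Edir, Evec, Fin.sum_univ_three]

/-- For `b ≠ 0`, on `U = {(x,y,z) : b(y+z) < 0}` with the Jacobi structure
`(Λ, E)` above, the functions `f₁ = 1`, `f₂ = y`, `f₃ = −e^{−2by}·Ei(−b(y+z))`
satisfy `Ef₁ = Ef₂ = Ef₃ = 0` (they are good Hamiltonian functions) and
`{f₂, f₃} = f₁`. -/
theorem stmt_7 (b : ℝ) (hb : b ≠ 0) (p : Fin 3 → ℝ)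
    (hp : p ∈ {q : Fin 3 → ℝ | b * (q 1 + q 2) < 0}) :
    Edir (Evec b) f₁ p = 0 ∧
    Edir (Evec b) f₂ p = 0 ∧
    Edir (Evec b) (f₃ b) p = 0 ∧
    jb (Lam b) (Evec b) f₂ (f₃ b) p = f₁ p := by
  have hp' : b * (p 1 + p 2) < 0 := hp
  have hs : p 1 + p 2 ≠ 0 := right_ne_zero_of_mul hp'.ne
  have h₂ : Edir (Evec b) f₂ p = 0 := by simp [Edir_Evec, pd_f₂]
  have h₃ : Edir (Evec b) (f₃ b) p = 0 := by simp [Edir_Evec, pd_f₃ hp']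
  refine ⟨?_, h₂, h₃, ?_⟩
  · have h₁ : pd 0 f₁ p = 0 := by
      rw [pd, show f₁ = fun _ => 1 from rfl, fderiv_fun_const]
      rfl
    rw [Edir_Evec, h₁, mul_zero]
  · simp only [jb, h₂, h₃, Fin.sum_univ_three, pd_f₂, pd_f₃ hp', Lam, f₁]
    simp [exp_neg]
    field_simp
end
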